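/- Let α, β ∈ ℝ with α ≠ β, let M be a Nevanlinna function, and suppose the function Q(z) = ((z−α)²/(z−β)²)·M(z) is a generalized Nevanlinna function with one negative square. If Im Q(z) ≠ 0 for every z ∈ ℂ⁺ at which Q is holomorphic (equivalently, no function Q_τ = (Q−τ)/(1+τQ), τ ∈ ℝ, has a zero in ℂ⁺, i.e. the path of the generalized zero of nonpositive type lies in the extended real line), then there exists c ∈ ℝ with c·(α−β) < 0 such that Q(z) = c·(z−α)/(z−β) for all z ∈ ℂ∖ℝ with z in the domain of holomorphy of Q. -/

import Mathlib

open Complex MeasureTheory Filter Set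

noncomputable def negEigCount {n : ℕ} (A : Matrix (Fin n) (Fin n) ℂ) : ℕ :=
  if h : A.IsHermitian then (Finset.univ.filter (fun i => h.eigenvalues i < 0)).card else 0

noncomputable def nevKernel (Q : ℂ → ℂ) {n : ℕ} (z : Fin n → ℂ) :
    Matrix (Fin n) (Fin n) ℂ :=
  Matrix.of fun i j => (Q (z i) - (starRingEnd ℂ) (Q (z j))) / (z i - (starRingEnd ℂ) (z j))

/-- A generalized Nevanlinna function with one negative square: `Q` is holomorphic on a
domain `D ⊆ ℂ∖ℝ` whose complement in `ℂ∖ℝ` is discrete, is symmetric with respect to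
conjugation, and the supremum over finite tuples of points of `D ∩ ℂ⁺` of the number of
negative eigenvalues of the Nevanlinna kernel matrix equals `1`. -/
structure IsGenNevanlinnaOne (Q : ℂ → ℂ) (D : Set ℂ) : Prop where
  subset : D ⊆ {z : ℂ | z.im ≠ 0}
  isOpen : IsOpen D
  discrete_compl : DiscreteTopology ↥({z : ℂ | z.im ≠ 0} \ D)
  holo : DifferentiableOn ℂ Q D
  conj_mem : ∀ z ∈ D, (starRingEnd ℂ) z ∈ D
  symm : ∀ z ∈ D, Q ((starRingEnd ℂ) z) = (starRingEnd ℂ) (Q z)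
  le_one : ∀ (n : ℕ) (z : Fin n → ℂ), (∀ i, z i ∈ D ∧ 0 < (z i).im) →
    negEigCount (nevKernel Q z) ≤ 1
  exists_one : ∃ (n : ℕ) (z : Fin n → ℂ), (∀ i, z i ∈ D ∧ 0 < (z i).im) ∧
    negEigCount (nevKernel Q z) = 1

/-- A Nevanlinna function. -/
structure IsNevanlinna (M : ℂ → ℂ) : Prop where
  holo : DifferentiableOn ℂ M {z : ℂ | z.im ≠ 0}
  symm : ∀ z : ℂ, z.im ≠ 0 → M ((starRingEnd ℂ) z) = (starRingEnd ℂ) (M z)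
  im_nonneg : ∀ z : ℂ, 0 < z.im → 0 ≤ (M z).im

/-- A holomorphic function on an open connected set that is non-real off a countable set is
non-real everywhere. -/
lemma im_ne_zero_of_countable_exception {g : ℂ → ℂ} {U E : Set ℂ} (hU : IsOpen U)
    (hUc : IsPreconnected U) (hg : DifferentiableOn ℂ g U) (hE : E.Countable)
    (him : ∀ z ∈ U \ E, (g z).im ≠ 0) : ∀ z ∈ U, (g z).im ≠ 0 := by
  intro z₀ hz₀ h0
  rcases (hg.analyticOnNhd hU).is_constant_or_isOpen hUc with ⟨w, hw⟩ | hopen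
  · obtain ⟨z, hzU, hzE⟩ := (hE.dense_compl ℝ).inter_open_nonempty U hU ⟨z₀, hz₀⟩
    exact him z ⟨hzU, hzE⟩ (by rw [hw z hzU, ← hw z₀ hz₀, h0])
  · have hcount : (((↑) : ℝ → ℂ) ⁻¹' (g '' E)).Countable :=
      (hE.image g).preimage ofReal_injective
    obtain ⟨t, ⟨z, hzU, hzt⟩, ht⟩ := (hcount.dense_compl ℝ).inter_open_nonempty
      (((↑) : ℝ → ℂ) ⁻¹' (g '' U)) ((hopen U subset_rfl hU).preimage continuous_ofReal)
      ⟨(g z₀).re, z₀, hz₀, by apply Complex.ext <;> simp [h0]⟩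
    exact him z ⟨hzU, fun hzE => ht ⟨z, hzE, hzt⟩⟩ (by simp [hzt])

lemma isOpen_upperHalfPlane : IsOpen {z : ℂ | 0 < z.im} :=
  isOpen_lt continuous_const continuous_im

lemma isConnected_upperHalfPlane : IsConnected {z : ℂ | 0 < z.im} :=
  (convex_halfSpace_im_gt 0).isConnected ⟨I, by simp⟩

lemma arg_mem_Ioo_of_im_pos {w : ℂ} (hw : 0 < w.im) : arg w ∈ Ioo 0 Real.pi := by
  refine ⟨lt_of_le_of_ne (arg_nonneg_iff.2 hw.le) fun h => hw.ne' ?_,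
    arg_lt_pi_iff.2 (Or.inr hw.ne')⟩
  exact (arg_eq_zero_iff.1 h.symm).2

/-- If `w` is in the upper half-plane, `Im (P / w) ≤ 0` and `0 ≤ Im (P * w)`, then the argument
of `P` is bounded in absolute value by both `arg w` and `π - arg w`. -/
lemma abs_arg_le_of_im_div_mul {P w : ℂ} (hP : P ≠ 0) (hw : 0 < w.im)
    (h₁ : (P / w).im ≤ 0) (h₂ : 0 ≤ (P * w).im) :
    |arg P| ≤ arg w ∧ |arg P| ≤ Real.pi - arg w := by
  have hw0 : w ≠ 0 := by rintro rfl; simp at hw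
  obtain ⟨hθ0, hθπ⟩ := arg_mem_Ioo_of_im_pos hw
  have hP1 := neg_pi_lt_arg P
  have hP2 := arg_le_pi P
  have hnP : 0 < ‖P‖ := norm_pos_iff.2 hP
  have hnw : 0 < ‖w‖ := norm_pos_iff.2 hw0
  have e₁ : (P / w).im = ‖P‖ / ‖w‖ * Real.sin (arg P - arg w) := by
    conv_lhs => rw [← norm_mul_exp_arg_mul_I P, ← norm_mul_exp_arg_mul_I w,
      mul_div_mul_comm, ← Complex.exp_sub, ← sub_mul, ← ofReal_sub, ← ofReal_div,
      im_ofReal_mul, exp_ofReal_mul_I_im]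
  have e₂ : (P * w).im = ‖P‖ * ‖w‖ * Real.sin (arg P + arg w) := by
    conv_lhs => rw [← norm_mul_exp_arg_mul_I P, ← norm_mul_exp_arg_mul_I w,
      mul_mul_mul_comm, ← Complex.exp_add, ← add_mul, ← ofReal_add, ← ofReal_mul,
      im_ofReal_mul, exp_ofReal_mul_I_im]
  have s₁ : Real.sin (arg P - arg w) ≤ 0 := by
    by_contra! h
    have : 0 < ‖P‖ / ‖w‖ * Real.sin (arg P - arg w) := by positivity
    linarith
  have s₂ : 0 ≤ Real.sin (arg P + arg w) := by
    by_contra! h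
    have := mul_neg_of_pos_of_neg (mul_pos hnP hnw) h
    linarith
  have a₁ : arg P ≤ arg w := by
    by_contra! h
    linarith [Real.sin_pos_of_pos_of_lt_pi (sub_pos.2 h) (by linarith)]
  have a₂ : arg w - Real.pi ≤ arg P := by
    by_contra! h
    have := Real.sin_pos_of_pos_of_lt_pi (x := arg P - arg w + 2 * Real.pi)
      (by linarith) (by linarith)
    rw [Real.sin_add_two_pi] at this
    linarith
  have a₃ : -arg w ≤ arg P := by
    by_contra! h
    linarith [Real.sin_neg_of_neg_of_neg_pi_lt (x := arg P + arg w) (by linarith) (by linarith)]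
  have a₄ : arg P ≤ Real.pi - arg w := by
    by_contra! h
    have := Real.sin_neg_of_neg_of_neg_pi_lt (x := arg P + arg w - 2 * Real.pi)
      (by linarith) (by linarith)
    rw [Real.sin_sub_two_pi] at this
    linarith
  exact ⟨abs_le.2 ⟨a₃, a₁⟩, abs_le.2 ⟨by linarith, a₄⟩⟩

/-- A holomorphic function on the strip `0 < Im ζ < π` whose real part is at most the distance
to the boundary has nonpositive real part. -/
lemma re_nonpos_of_le_dist_strip {f : ℂ → ℂ}
    (hf : DifferentiableOn ℂ f (im ⁻¹' Ioo 0 Real.pi))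
    (h : ∀ z ∈ im ⁻¹' Ioo 0 Real.pi, (f z).re ≤ z.im ∧ (f z).re ≤ Real.pi - z.im) :
    ∀ z ∈ im ⁻¹' Ioo 0 Real.pi, (f z).re ≤ 0 := by
  rintro z ⟨hz0, hzπ⟩
  refine le_of_forall_pos_le_add fun ε hε => ?_
  rw [zero_add]
  obtain ⟨δ, hδ0, hδ⟩ : ∃ δ > 0, δ < min ε (min z.im (Real.pi - z.im)) :=
    exists_between (lt_min hε (lt_min hz0 (sub_pos.2 hzπ)))
  simp only [lt_min_iff] at hδ
  obtain ⟨hδε, hδz, hδz'⟩ := hδ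
  have hcl : closure (im ⁻¹' Ioo δ (Real.pi - δ)) ⊆ im ⁻¹' Ioo 0 Real.pi := by
    refine (closure_minimal (preimage_mono Ioo_subset_Icc_self)
      (isClosed_Icc.preimage continuous_im)).trans (preimage_mono ?_)
    exact Icc_subset_Ioo hδ0 (by linarith)
  have key : ‖Complex.exp (f z)‖ ≤ Real.exp δ := by
    refine PhragmenLindelof.horizontal_strip (f := fun z => Complex.exp (f z))
      (a := δ) (b := Real.pi - δ) ?_ ?_ ?_ ?_ hδz.le (by linarith)
    · exact (hf.cexp.mono hcl).diffContOnCl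
    · refine ⟨0, div_pos Real.pi_pos (by linarith), Real.pi, ?_⟩
      refine Asymptotics.IsBigO.of_bound 1 ?_
      refine eventually_inf_principal.2 (Eventually.of_forall fun x hx => ?_)
      have := (h x (hcl (subset_closure hx))).1
      have hx2 : x.im < Real.pi - δ := hx.2
      simp only [norm_exp, zero_mul, Real.exp_zero, mul_one, one_mul, Real.norm_eq_abs,
        Real.abs_exp, Real.exp_le_exp]
      linarith
    · intro x hx
      rw [norm_exp, Real.exp_le_exp, ← hx]
      exact (h x ⟨by linarith, by linarith⟩).1
    · intro x hx
      rw [norm_exp, Real.exp_le_exp]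
      have := (h x ⟨by linarith, by linarith⟩).2
      linarith
  rw [norm_exp, Real.exp_le_exp] at key
  linarith

/-- A zero-free function `N` on the upper half-plane with `Im N ≥ 0` and `Im (w ^ 2 * N) ≤ 0` is
of the form `-p / w` with `p > 0`. -/
lemma exists_mul_eq_neg_of_im {N : ℂ → ℂ} (hN : DifferentiableOn ℂ N {w : ℂ | 0 < w.im})
    (hN0 : ∀ w : ℂ, 0 < w.im → N w ≠ 0) (h₁ : ∀ w : ℂ, 0 < w.im → 0 ≤ (N w).im)
    (h₂ : ∀ w : ℂ, 0 < w.im → (w ^ 2 * N w).im ≤ 0) :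
    ∃ p : ℝ, 0 < p ∧ ∀ w : ℂ, 0 < w.im → w * N w = -p := by
  have hw0 : ∀ w : ℂ, 0 < w.im → w ≠ 0 := by rintro w hw rfl; simp at hw
  set P : ℂ → ℂ := fun w => -(w * N w) with hPdef
  have hPd : DifferentiableOn ℂ P {w : ℂ | 0 < w.im} := (differentiableOn_id.mul hN).neg
  have hP0 : ∀ w : ℂ, 0 < w.im → P w ≠ 0 := fun w hw =>
    neg_ne_zero.2 (mul_ne_zero (hw0 w hw) (hN0 w hw))
  have harg : ∀ w : ℂ, 0 < w.im → |arg (P w)| ≤ arg w ∧ |arg (P w)| ≤ Real.pi - arg w := by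
    intro w hw
    refine abs_arg_le_of_im_div_mul (hP0 w hw) hw ?_ ?_
    · have : P w / w = -N w := by simp only [hPdef]; field_simp [hw0 w hw]
      rw [this, neg_im]
      linarith [h₁ w hw]
    · have : P w * w = -(w ^ 2 * N w) := by simp only [hPdef]; ring
      rw [this, neg_im]
      linarith [h₂ w hw]
  have hslit : ∀ w : ℂ, 0 < w.im → P w ∈ slitPlane := fun w hw =>
    mem_slitPlane_iff_arg.2 ⟨fun h => by
      have := harg w hw
      rw [h, abs_of_pos Real.pi_pos] at this
      linarith [Real.pi_pos], hP0 w hw⟩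
  have hexp : ∀ z ∈ im ⁻¹' Ioo 0 Real.pi, 0 < (Complex.exp z).im := by
    rintro z ⟨hz0, hzπ⟩
    rw [exp_im]
    exact mul_pos (Real.exp_pos _) (Real.sin_pos_of_pos_of_lt_pi hz0 hzπ)
  have hL : DifferentiableOn ℂ (fun z => Complex.log (P (Complex.exp z)))
      (im ⁻¹' Ioo 0 Real.pi) :=
    (hPd.comp Complex.differentiable_exp.differentiableOn hexp).clog
      fun z hz => hslit _ (hexp z hz)
  have hbound : ∀ z ∈ im ⁻¹' Ioo 0 Real.pi,
      |arg (P (Complex.exp z))| ≤ z.im ∧ |arg (P (Complex.exp z))| ≤ Real.pi - z.im := by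
    intro z hz
    have := harg _ (hexp z hz)
    rwa [arg_exp, (toIocMod_eq_self _).2 ⟨by linarith [hz.1, Real.pi_pos], by linarith [hz.2]⟩]
      at this
  have hup := re_nonpos_of_le_dist_strip (hL.const_mul (-I)) fun z hz => by
    have := hbound z hz
    have h' := le_abs_self (arg (P (Complex.exp z)))
    simp only [neg_mul, neg_re, I_mul_re, log_im, neg_neg]
    exact ⟨h'.trans this.1, h'.trans this.2⟩
  have hlow := re_nonpos_of_le_dist_strip (hL.const_mul I) fun z hz => by
    have := hbound z hz
    have h' := neg_le_abs (arg (P (Complex.exp z)))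
    simp only [I_mul_re, log_im]
    exact ⟨h'.trans this.1, h'.trans this.2⟩
  have hreal : ∀ w : ℂ, 0 < w.im → 0 < (P w).re ∧ (P w).im = 0 := by
    intro w hw
    have hlog : Complex.log w ∈ im ⁻¹' Ioo 0 Real.pi := by
      rw [mem_preimage, log_im]
      exact arg_mem_Ioo_of_im_pos hw
    have u := hup _ hlog
    have l := hlow _ hlog
    simp only [neg_mul, neg_re, I_mul_re, log_im, neg_neg, exp_log (hw0 w hw)] at u l
    obtain ⟨hre, him⟩ := arg_eq_zero_iff.1 (le_antisymm u (by linarith))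
    refine ⟨lt_of_le_of_ne hre fun h => hP0 w hw ?_, him⟩
    exact Complex.ext h.symm him
  obtain ⟨p, hp⟩ := AnalyticOnNhd.eq_const_add_im_mul_I_of_re_eq_const
    (hPd.analyticOnNhd isOpen_upperHalfPlane) (fun w hw => (hreal w hw).2)
    isOpen_upperHalfPlane isConnected_upperHalfPlane
  refine ⟨p, ?_, fun w hw => ?_⟩
  · have := (hreal I (by simp)).1
    rw [hp I (by simp)] at this
    simpa using this
  · have := hp w hw
    simp only [hPdef, ofReal_zero, zero_mul, add_zero] at this
    rw [← this, neg_neg]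

/-- A Nevanlinna-type function `M` on the upper half-plane for which `((z - α) / (z - β)) ^ 2 * M`
has no real values is a multiple of `(z - β) / (z - α)`. -/
lemma exists_eq_of_im_ne_zero {M : ℂ → ℂ} {α β : ℝ} (hαβ : α ≠ β)
    (hM : DifferentiableOn ℂ M {z : ℂ | 0 < z.im}) (hpos : ∀ z : ℂ, 0 < z.im → 0 ≤ (M z).im)
    (him : ∀ z : ℂ, 0 < z.im → ((z - α) ^ 2 / (z - β) ^ 2 * M z).im ≠ 0) :
    ∃ c : ℝ, c * (α - β) < 0 ∧
      ∀ z : ℂ, 0 < z.im → (z - α) ^ 2 / (z - β) ^ 2 * M z = c * (z - α) / (z - β) := by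
  obtain ⟨σ, hσ, hσpos⟩ : ∃ σ : ℝ, σ ^ 2 = 1 ∧ 0 < σ * (α - β) := by
    rcases hαβ.lt_or_gt with h | h
    · exact ⟨-1, by norm_num, by linarith⟩
    · exact ⟨1, by norm_num, by linarith⟩
  have hσC : (σ : ℂ) ^ 2 = 1 := by exact_mod_cast hσ
  have hsub : ∀ (z : ℂ) (x : ℝ), 0 < z.im → z - x ≠ 0 := by
    intro z x hz h
    have := congrArg im h
    simp at this
    exact hz.ne' this
  have hden : ∀ w : ℂ, 0 < w.im → σ * w - 1 ≠ 0 := by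
    intro w hw h
    have := congrArg im h
    simp at this
    rcases this with h | h
    · simp [h] at hσ
    · exact hw.ne' h
  set φ : ℂ → ℂ := fun w => β + (β - α) / (σ * w - 1) with hφ
  have hφim : ∀ w : ℂ, 0 < w.im → 0 < (φ w).im := by
    intro w hw
    have : (φ w).im = σ * (α - β) * w.im / normSq (σ * w - 1) := by
      simp only [hφ]
      rw [← ofReal_sub]
      simp [div_im]
      ring
    rw [this]
    exact div_pos (mul_pos hσpos hw) (normSq_pos.2 (hden w hw))
  have hφw : ∀ w : ℂ, 0 < w.im → (φ w - α) ^ 2 / (φ w - β) ^ 2 = w ^ 2 := by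
    intro w hw
    have h1 := hden w hw
    have h2 : (β - α : ℂ) ≠ 0 := by
      rw [← ofReal_sub, ofReal_ne_zero]; exact sub_ne_zero.2 hαβ.symm
    have h3 : (φ w - α) / (φ w - β) = σ * w := by
      rw [show φ w - β = (β - α) / (σ * w - 1) by simp only [hφ]; ring,
        show φ w - α = (β - α) / (σ * w - 1) * (σ * w) by simp only [hφ]; field_simp; ring,
        mul_div_cancel_left₀ _ (div_ne_zero h2 h1)]
    rw [← div_pow, h3, mul_pow, hσC, one_mul]
  have hψ : ∀ z : ℂ, 0 < z.im → 0 < (σ * ((z - α) / (z - β))).im ∧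
      φ (σ * ((z - α) / (z - β))) = z := by
    intro z hz
    have h1 := hsub z β hz
    have h2 : (β - α : ℂ) ≠ 0 := by
      rw [← ofReal_sub, ofReal_ne_zero]; exact sub_ne_zero.2 hαβ.symm
    constructor
    · have : (σ * ((z - α) / (z - β))).im = σ * (α - β) * z.im / normSq (z - β) := by
        simp [div_im]
        ring
      rw [this]
      exact div_pos (mul_pos hσpos hz) (normSq_pos.2 h1)
    · have : σ * (σ * ((z - α) / (z - β))) - 1 = (β - α) / (z - β) := by
        rw [← mul_assoc, ← sq, hσC]
        field_simp
        ring
      simp only [hφ, this]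
      field_simp
      ring
  have hneg : ∀ z : ℂ, 0 < z.im → ((z - α) ^ 2 / (z - β) ^ 2 * M z).im < 0 := by
    have hcont : ContinuousOn (fun z : ℂ => ((z - α) ^ 2 / (z - β) ^ 2 * M z).im)
        {z : ℂ | 0 < z.im} := by
      refine continuous_im.comp_continuousOn (ContinuousOn.mul (ContinuousOn.div
        (by fun_prop) (by fun_prop) fun z hz => pow_ne_zero _ (hsub z β hz)) hM.continuousOn)
    intro z hz
    by_contra! hge
    have hI := hφim I (by simp)
    have hle : ((φ I - α) ^ 2 / (φ I - β) ^ 2 * M (φ I)).im ≤ 0 := by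
      rw [hφw I (by simp)]
      simpa using hpos _ hI
    obtain ⟨x, hx, hx0⟩ := isConnected_upperHalfPlane.isPreconnected.intermediate_value
      hI hz hcont ⟨hle, hge⟩
    exact him x hx hx0
  obtain ⟨p, hp, hpN⟩ := exists_mul_eq_neg_of_im (N := fun w => M (φ w))
    (hM.comp (DifferentiableOn.add (by fun_prop) (DifferentiableOn.div (by fun_prop)
      (by fun_prop) hden)) hφim)
    (fun w hw h => (hneg _ (hφim w hw)).ne (by simp only [h]; simp))
    (fun w hw => hpos _ (hφim w hw))
    (fun w hw => by rw [← hφw w hw]; exact (hneg _ (hφim w hw)).le)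
  refine ⟨-p * σ, by nlinarith, fun z hz => ?_⟩
  obtain ⟨h1, h2⟩ := hψ z hz
  have h3 := hpN _ h1
  simp only [h2] at h3
  have h4 : (z - α) / (z - β) * M z = -p * σ := by
    linear_combination (σ : ℂ) * h3 - (z - α) / (z - β) * M z * hσC
  rw [← div_pow, sq, mul_assoc, h4]
  push_cast
  ring

/-- Let `Q = ((z−α)²/(z−β)²)·M` (with `α, β ∈ ℝ`, `α ≠ β`, `M` a
Nevanlinna function) be a generalized Nevanlinna function with one negative square.
If `Im Q(z) ≠ 0` for every `z ∈ ℂ⁺` in the domain of holomorphy of `Q` (so the path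
of the generalized zero of nonpositive type lies in the extended real line), then
`Q(z) = c(z−α)/(z−β)` for some `c ∈ ℝ` with `c(α−β) < 0`. -/
theorem statement19 (Q : ℂ → ℂ) (D : Set ℂ) (hQ : IsGenNevanlinnaOne Q D)
    (α β : ℝ) (hαβ : α ≠ β) (M : ℂ → ℂ) (hM : IsNevanlinna M)
    (hfac : ∀ z ∈ D, Q z = ((z - (α : ℂ)) ^ 2 / (z - (β : ℂ)) ^ 2) * M z)
    (him : ∀ z ∈ D, 0 < z.im → (Q z).im ≠ 0) :
    ∃ c : ℝ, c * (α - β) < 0 ∧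
      ∀ z ∈ D, Q z = (c : ℂ) * (z - (α : ℂ)) / (z - (β : ℂ)) := by
  have hE : ({z : ℂ | z.im ≠ 0} \ D).Countable := by
    have := hQ.discrete_compl
    exact countable_coe_iff.1 (TopologicalSpace.separableSpace_iff_countable.1 inferInstance)
  have hMd : DifferentiableOn ℂ M {z : ℂ | 0 < z.im} :=
    hM.holo.mono fun z (hz : 0 < z.im) => hz.ne'
  have hg : DifferentiableOn ℂ (fun z : ℂ => (z - α) ^ 2 / (z - β) ^ 2 * M z)
      {z : ℂ | 0 < z.im} := by
    refine DifferentiableOn.mul (DifferentiableOn.div (by fun_prop) (by fun_prop) ?_) hMd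
    intro z (hz : 0 < z.im)
    refine pow_ne_zero _ fun h => hz.ne' ?_
    simpa using congrArg im h
  have hne := im_ne_zero_of_countable_exception isOpen_upperHalfPlane
    isConnected_upperHalfPlane.isPreconnected hg hE fun z ⟨hz, hzE⟩ => by
      have hzD : z ∈ D := by
        by_contra h
        exact hzE ⟨ne_of_gt hz, h⟩
      rw [← hfac z hzD]
      exact him z hzD hz
  obtain ⟨c, hc, hcM⟩ := exists_eq_of_im_ne_zero hαβ hMd hM.im_nonneg hne
  refine ⟨c, hc, fun z hz => ?_⟩
  rcases lt_or_gt_of_ne (hQ.subset hz) with h | h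
  · have hz' := hQ.conj_mem z hz
    have := hQ.symm z hz
    rw [hfac _ hz', hcM _ (by simpa using h)] at this
    have := congrArg (starRingEnd ℂ) this
    simpa using this.symm
  · rw [hfac z hz, hcM z h]
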